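/- Let A, B be n×n positive semidefinite complex matrices, X an arbitrary n×n complex matrix, 0 ≤ ν ≤ 1 and N ∈ ℕ with N ≥ 2. Then ‖A^{ν} X B^{1−ν}‖₂² + s_1(ν)² ‖AX − XB‖₂² + ∑_{j=2}^{N} s_j(ν) ‖ A^{k_j(ν)/2^{j−1}} X B^{1−k_j(ν)/2^{j−1}} − A^{(k_j(ν)+1)/2^{j−1}} X B^{1−(k_j(ν)+1)/2^{j−1}} ‖₂² ≤ ‖ν AX + (1−ν) XB‖₂². -/

import Mathlib

open Real Finset

noncomputable def kj (j : ℕ) (ν : ℝ) : ℤ := ⌊(2:ℝ)^(j-1) * ν⌋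

noncomputable def rj (j : ℕ) (ν : ℝ) : ℤ := ⌊(2:ℝ)^j * ν⌋

noncomputable def sj (j : ℕ) (ν : ℝ) : ℝ :=
  (-1:ℝ)^(rj j ν) * (2:ℝ)^(j-1) * ν
    + (-1:ℝ)^(rj j ν + 1) * (⌊((rj j ν : ℝ) + 1)/2⌋ : ℤ)

noncomputable def SS (N : ℕ) (ν a b : ℝ) : ℝ :=
  ∑ j ∈ Finset.Icc 1 N, sj j ν *
    ((b ^ ((2:ℝ)^(j-1) - (kj j ν : ℝ)) * a ^ ((kj j ν : ℝ))) ^ ((1:ℝ)/2^j)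
      - (a ^ ((kj j ν : ℝ) + 1) * b ^ ((2:ℝ)^(j-1) - (kj j ν : ℝ) - 1)) ^ ((1:ℝ)/2^j))^2

open scoped ComplexOrder

noncomputable def mpow {n : Type*} [Fintype n] [DecidableEq n]
    (A : Matrix n n ℂ) (t : ℝ) : Matrix n n ℂ :=
  cfc (fun x : ℝ => x ^ t) A

noncomputable def gm {n : Type*} [Fintype n] [DecidableEq n]
    (A B : Matrix n n ℂ) (t : ℝ) : Matrix n n ℂ :=
  mpow A (1/2) * mpow (mpow A (-(1/2)) * B * mpow A (-(1/2))) t * mpow A (1/2)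

noncomputable def hsNorm {n : Type*} [Fintype n] (X : Matrix n n ℂ) : ℝ :=
  Real.sqrt (∑ i, ∑ j, ‖X i j‖^2)

/-- The weighted geometric mean `a ^ y * b ^ (1 - y)`. -/
noncomputable def wgm (a b y : ℝ) : ℝ := a ^ y * b ^ (1 - y)

/-- Piecewise linear interpolation of `(wgm a b ν) ^ 2` at the dyadic mesh of size `2⁻ⁱ`. -/
noncomputable def dyadicInterp (a b ν : ℝ) (i : ℕ) : ℝ :=
  (1 - Int.fract (2 ^ i * ν)) * wgm a b (⌊2 ^ i * ν⌋ / 2 ^ i) ^ 2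
    + Int.fract (2 ^ i * ν) * wgm a b ((⌊2 ^ i * ν⌋ + 1) / 2 ^ i) ^ 2

lemma wgm_mul_wgm {a b x y : ℝ} (ha : 0 ≤ a) (hb : 0 ≤ b) (hx : 0 ≤ x) (hx' : x ≤ 1)
    (hy : 0 ≤ y) (hy' : y ≤ 1) : wgm a b x * wgm a b y = wgm a b ((x + y) / 2) ^ 2 := by
  have key {c u v : ℝ} (hc : 0 ≤ c) (hu : 0 ≤ u) (hv : 0 ≤ v) :
      c ^ u * c ^ v = (c ^ ((u + v) / 2)) ^ 2 := by
    rw [← rpow_add_of_nonneg hc hu hv, ← rpow_mul_natCast hc]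
    congr 1; push_cast; ring
  have h1 := key ha hx hy
  have h2 := key hb (sub_nonneg.2 hx') (sub_nonneg.2 hy')
  unfold wgm
  rw [show 1 - (x + y) / 2 = (1 - x + (1 - y)) / 2 by ring, mul_pow, ← h1, ← h2]
  ring

lemma sq_wgm_le {a b x y t : ℝ} (ha : 0 ≤ a) (hb : 0 ≤ b) (hx : 0 ≤ x) (hx' : x ≤ 1)
    (hy : 0 ≤ y) (hy' : y ≤ 1) (ht : 0 ≤ t) (ht' : t ≤ 1) :
    wgm a b ((1 - t) * x + t * y) ^ 2 ≤ (1 - t) * wgm a b x ^ 2 + t * wgm a b y ^ 2 := by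
  have ht1 : 0 ≤ 1 - t := sub_nonneg.2 ht'
  have key {c u v : ℝ} (hc : 0 ≤ c) (hu : 0 ≤ u) (hv : 0 ≤ v) :
      c ^ ((1 - t) * u + t * v) = (c ^ u) ^ (1 - t) * (c ^ v) ^ t := by
    rw [rpow_add_of_nonneg hc (mul_nonneg ht1 hu) (mul_nonneg ht hv), ← rpow_mul hc,
      ← rpow_mul hc, mul_comm u, mul_comm v]
  have hw (z : ℝ) : 0 ≤ wgm a b z := mul_nonneg (rpow_nonneg ha _) (rpow_nonneg hb _)
  have heq : wgm a b ((1 - t) * x + t * y) = wgm a b x ^ (1 - t) * wgm a b y ^ t := by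
    unfold wgm
    rw [show 1 - ((1 - t) * x + t * y) = (1 - t) * (1 - x) + t * (1 - y) by ring,
      key ha hx hy, key hb (sub_nonneg.2 hx') (sub_nonneg.2 hy'),
      mul_rpow (rpow_nonneg ha _) (rpow_nonneg hb _),
      mul_rpow (rpow_nonneg ha _) (rpow_nonneg hb _)]
    ring
  have hle := geom_mean_le_arith_mean2_weighted ht1 ht (hw x) (hw y) (by ring)
  rw [← heq] at hle
  calc wgm a b ((1 - t) * x + t * y) ^ 2
      ≤ ((1 - t) * wgm a b x + t * wgm a b y) ^ 2 := pow_le_pow_left₀ (hw _) hle 2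
    _ ≤ _ := by nlinarith [mul_nonneg (mul_nonneg ht ht1) (sq_nonneg (wgm a b x - wgm a b y))]

lemma floor_two_mul_and_sj (i : ℕ) (ν : ℝ) :
    (Int.fract (2 ^ i * ν) < 1 / 2 ∧ ⌊2 ^ (i + 1) * ν⌋ = 2 * ⌊2 ^ i * ν⌋ ∧
      sj (i + 1) ν = Int.fract (2 ^ i * ν)) ∨
    (1 / 2 ≤ Int.fract (2 ^ i * ν) ∧ ⌊2 ^ (i + 1) * ν⌋ = 2 * ⌊2 ^ i * ν⌋ + 1 ∧
      sj (i + 1) ν = 1 - Int.fract (2 ^ i * ν)) := by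
  have hk := Int.floor_add_fract ((2:ℝ) ^ i * ν)
  have h2 : (2:ℝ) ^ (i + 1) * ν = 2 * (2 ^ i * ν) := by ring
  have ht0 := Int.fract_nonneg ((2:ℝ) ^ i * ν)
  have ht1 := Int.fract_lt_one ((2:ℝ) ^ i * ν)
  simp only [sj, rj, Nat.add_sub_cancel]
  generalize ⌊(2:ℝ) ^ i * ν⌋ = k at *
  generalize Int.fract ((2:ℝ) ^ i * ν) = t at *
  rcases lt_or_ge t (1 / 2) with h | h
  · left
    have hr : ⌊(2:ℝ) ^ (i + 1) * ν⌋ = 2 * k := by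
      rw [Int.floor_eq_iff]; push_cast; constructor <;> linarith
    have hf : ⌊(((2 * k : ℤ) : ℝ) + 1) / 2⌋ = k := by
      rw [Int.floor_eq_iff]; push_cast; constructor <;> linarith
    have he : Even (2 * k) := even_two_mul k
    refine ⟨h, hr, ?_⟩
    rw [hr, hf, he.neg_one_zpow, he.add_one.neg_one_zpow]
    linarith
  · right
    have hr : ⌊(2:ℝ) ^ (i + 1) * ν⌋ = 2 * k + 1 := by
      rw [Int.floor_eq_iff]; push_cast; constructor <;> linarith
    have hf : ⌊(((2 * k + 1 : ℤ) : ℝ) + 1) / 2⌋ = k + 1 := by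
      rw [Int.floor_eq_iff]; push_cast; constructor <;> linarith
    have ho : Odd (2 * k + 1) := odd_two_mul_add_one k
    refine ⟨h, hr, ?_⟩
    rw [hr, hf, ho.neg_one_zpow, ho.add_one.neg_one_zpow]
    push_cast
    linarith

lemma floor_div_two_pow_mem {ν : ℝ} (h0 : 0 ≤ ν) (h1 : ν < 1) (i : ℕ) :
    0 ≤ (⌊2 ^ i * ν⌋ : ℝ) / 2 ^ i ∧ ((⌊2 ^ i * ν⌋ : ℝ) + 1) / 2 ^ i ≤ 1 := by
  have hm : (0:ℝ) < 2 ^ i := by positivity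
  have hk : (0:ℤ) ≤ ⌊(2:ℝ) ^ i * ν⌋ := Int.floor_nonneg.2 (by positivity)
  have hk' : ⌊(2:ℝ) ^ i * ν⌋ < 2 ^ i := by
    rw [Int.floor_lt]; push_cast; nlinarith
  have hk'' : ⌊(2:ℝ) ^ i * ν⌋ + 1 ≤ 2 ^ i := hk'
  refine ⟨div_nonneg (by exact_mod_cast hk) hm.le, ?_⟩
  rw [div_le_one hm]
  exact_mod_cast hk''

lemma dyadicInterp_succ {a b ν : ℝ} (ha : 0 ≤ a) (hb : 0 ≤ b) (h0 : 0 ≤ ν) (h1 : ν < 1)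
    (i : ℕ) :
    sj (i + 1) ν * (wgm a b (⌊2 ^ i * ν⌋ / 2 ^ i) - wgm a b ((⌊2 ^ i * ν⌋ + 1) / 2 ^ i)) ^ 2
      + dyadicInterp a b ν (i + 1) = dyadicInterp a b ν i := by
  obtain ⟨hx, hy⟩ := floor_div_two_pow_mem h0 h1 i
  have hm : (0:ℝ) < 2 ^ i := by positivity
  have hxy : (⌊2 ^ i * ν⌋ : ℝ) / 2 ^ i ≤ ((⌊2 ^ i * ν⌋ : ℝ) + 1) / 2 ^ i := by gcongr; linarith
  have hmul := wgm_mul_wgm ha hb hx (hxy.trans hy) (hx.trans hxy) hy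
  have hfr : Int.fract ((2:ℝ) ^ (i + 1) * ν) = 2 ^ (i + 1) * ν - ⌊(2:ℝ) ^ (i + 1) * ν⌋ := rfl
  have hk := Int.floor_add_fract ((2:ℝ) ^ i * ν)
  have h2 : (2:ℝ) ^ (i + 1) * ν = 2 * (2 ^ i * ν) := by ring
  have hmid : ((⌊2 ^ i * ν⌋ : ℝ) / 2 ^ i + ((⌊2 ^ i * ν⌋ : ℝ) + 1) / 2 ^ i) / 2
      = (2 * ⌊2 ^ i * ν⌋ + 1) / 2 ^ (i + 1) := by field_simp; ring
  rw [hmid] at hmul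
  unfold dyadicInterp
  rcases floor_two_mul_and_sj i ν with ⟨-, hr, hs⟩ | ⟨-, hr, hs⟩
  · rw [hfr, hr, hs]
    push_cast
    rw [← hmul, show (2 * (⌊2 ^ i * ν⌋ : ℝ)) / 2 ^ (i + 1) = ⌊2 ^ i * ν⌋ / 2 ^ i by field_simp; ring,
      show (2:ℝ) ^ (i + 1) * ν - 2 * ⌊2 ^ i * ν⌋ = 2 * Int.fract ((2:ℝ) ^ i * ν) by linarith]
    ring
  · rw [hfr, hr, hs]
    push_cast
    rw [← hmul, show (2 * (⌊2 ^ i * ν⌋ : ℝ) + 1 + 1) / 2 ^ (i + 1) = (⌊2 ^ i * ν⌋ + 1) / 2 ^ i by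
        field_simp; ring,
      show (2:ℝ) ^ (i + 1) * ν - (2 * ⌊2 ^ i * ν⌋ + 1) = 2 * Int.fract ((2:ℝ) ^ i * ν) - 1 by
        linarith]
    ring

lemma sq_wgm_le_dyadicInterp {a b ν : ℝ} (ha : 0 ≤ a) (hb : 0 ≤ b) (h0 : 0 ≤ ν) (h1 : ν < 1)
    (i : ℕ) : wgm a b ν ^ 2 ≤ dyadicInterp a b ν i := by
  obtain ⟨hx, hy⟩ := floor_div_two_pow_mem h0 h1 i
  have hm : (0:ℝ) < 2 ^ i := by positivity
  have hxy : (⌊2 ^ i * ν⌋ : ℝ) / 2 ^ i ≤ ((⌊2 ^ i * ν⌋ : ℝ) + 1) / 2 ^ i := by gcongr; linarith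
  have hk := Int.floor_add_fract ((2:ℝ) ^ i * ν)
  have hle := sq_wgm_le ha hb hx (hxy.trans hy) (hx.trans hxy) hy
    (Int.fract_nonneg ((2:ℝ) ^ i * ν)) (Int.fract_lt_one ((2:ℝ) ^ i * ν)).le
  unfold dyadicInterp
  convert hle using 3
  generalize (⌊2 ^ i * ν⌋ : ℝ) = k at *
  generalize Int.fract ((2:ℝ) ^ i * ν) = t at *
  field_simp
  linarith

lemma sj_one_sub_sq {ν : ℝ} (h0 : 0 ≤ ν) (h1 : ν < 1) : sj 1 ν - sj 1 ν ^ 2 = ν * (1 - ν) := by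
  have hf : Int.fract ((2:ℝ) ^ 0 * ν) = ν := by simpa using Int.fract_eq_self.2 ⟨h0, h1⟩
  rcases floor_two_mul_and_sj 0 ν with ⟨-, -, hs⟩ | ⟨-, -, hs⟩ <;>
    rw [hf] at hs <;> simp only [zero_add] at hs <;> rw [hs] <;> ring

lemma sj_eq_zero_of_one (i : ℕ) : sj (i + 1) 1 = 0 := by
  have hf : Int.fract ((2:ℝ) ^ i * 1) = 0 := by
    have := Int.fract_intCast (R := ℝ) (2 ^ i)
    push_cast at this
    simpa using this
  rcases floor_two_mul_and_sj i 1 with ⟨-, -, hs⟩ | ⟨h, -, -⟩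
  · rw [hs, hf]
  · rw [hf] at h; norm_num at h

/-- The refined Young inequality for scalars. -/
lemma refined_young_sq {a b ν : ℝ} (ha : 0 ≤ a) (hb : 0 ≤ b) (h0 : 0 ≤ ν) (h1 : ν ≤ 1)
    (N : ℕ) (hN : 1 ≤ N) :
    wgm a b ν ^ 2 + sj 1 ν ^ 2 * (wgm a b 1 - wgm a b 0) ^ 2
      + ∑ j ∈ Finset.Icc 2 N, sj j ν *
          (wgm a b (kj j ν / 2 ^ (j - 1)) - wgm a b ((kj j ν + 1) / 2 ^ (j - 1))) ^ 2
      ≤ (ν * wgm a b 1 + (1 - ν) * wgm a b 0) ^ 2 := by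
  rcases h1.eq_or_lt with rfl | h1
  · rw [Finset.sum_eq_zero, show sj 1 1 = 0 from sj_eq_zero_of_one 0]
    · norm_num
    · intro j hj
      obtain ⟨i, rfl⟩ : ∃ i, j = i + 1 := ⟨j - 1, by have := (Finset.mem_Icc.1 hj).1; omega⟩
      rw [sj_eq_zero_of_one, zero_mul]
  have hind : ∑ j ∈ Finset.Icc 2 N, sj j ν *
      (wgm a b (kj j ν / 2 ^ (j - 1)) - wgm a b ((kj j ν + 1) / 2 ^ (j - 1))) ^ 2
      + dyadicInterp a b ν N = dyadicInterp a b ν 1 := by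
    induction N, hN using Nat.le_induction with
    | base => simp
    | succ m hm ih =>
      rw [Finset.sum_Icc_succ_top (by omega), ← ih, ← dyadicInterp_succ ha hb h0 h1 m]
      simp only [kj, Nat.add_sub_cancel]
      ring
  have hle := sq_wgm_le_dyadicInterp ha hb h0 h1 N
  have hzero := dyadicInterp_succ ha hb h0 h1 0
  have hfl : ⌊ν⌋ = 0 := Int.floor_eq_zero_iff.2 ⟨h0, h1⟩
  have hfr : Int.fract ν = ν := Int.fract_eq_self.2 ⟨h0, h1⟩
  simp only [dyadicInterp, pow_zero, one_mul, hfl, hfr, Int.cast_zero, div_one, zero_add] at hzero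
  change _ + dyadicInterp a b ν 1 = _ at hzero
  have hs := sj_one_sub_sq h0 h1
  linear_combination hle + hind + hzero - (wgm a b 1 - wgm a b 0) ^ 2 * hs

lemma sq_hsNorm {n : Type*} [Fintype n] (M : Matrix n n ℂ) :
    hsNorm M ^ 2 = ∑ i, ∑ j, ‖M i j‖ ^ 2 :=
  Real.sq_sqrt (by positivity)

lemma sq_hsNorm_eq_trace {n : Type*} [Fintype n] (M : Matrix n n ℂ) :
    ((hsNorm M ^ 2 : ℝ) : ℂ) = (M * star M).trace := by
  rw [sq_hsNorm]
  simp [Matrix.trace, Matrix.mul_apply, Matrix.star_apply, Complex.mul_conj']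

lemma sq_hsNorm_unitary_conj {n : Type*} [Fintype n] [DecidableEq n]
    (U V : Matrix.unitaryGroup n ℂ) (M : Matrix n n ℂ) :
    hsNorm ((U : Matrix n n ℂ) * M * star (V : Matrix n n ℂ)) ^ 2 = hsNorm M ^ 2 := by
  have hU : star (U : Matrix n n ℂ) * U = 1 := Unitary.coe_star_mul_self U
  have hV : star (V : Matrix n n ℂ) * V = 1 := Unitary.coe_star_mul_self V
  have h : ((U : Matrix n n ℂ) * M * star (V : Matrix n n ℂ))
      * star ((U : Matrix n n ℂ) * M * star (V : Matrix n n ℂ))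
      = U * (M * star M * star (U : Matrix n n ℂ)) := by
    simp only [star_mul, star_star]
    calc _ = (U : Matrix n n ℂ) * M * (star (V : Matrix n n ℂ) * V) * star M
          * star (U : Matrix n n ℂ) := by simp only [mul_assoc]
      _ = _ := by rw [hV]; simp only [mul_assoc, mul_one]
  have : ((hsNorm ((U : Matrix n n ℂ) * M * star (V : Matrix n n ℂ)) ^ 2 : ℝ) : ℂ)
      = ((hsNorm M ^ 2 : ℝ) : ℂ) := by
    rw [sq_hsNorm_eq_trace, sq_hsNorm_eq_trace, h, Matrix.trace_mul_comm, mul_assoc, hU, mul_one]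
  exact_mod_cast this

lemma exists_mpow_eq_conj {n : Type*} [Fintype n] [DecidableEq n] {A : Matrix n n ℂ}
    (hA : A.PosSemidef) :
    ∃ (U : Matrix.unitaryGroup n ℂ) (a : n → ℝ), (∀ i, 0 ≤ a i) ∧ ∀ t : ℝ,
      mpow A t = (U : Matrix n n ℂ) * Matrix.diagonal (fun i => ((a i ^ t : ℝ) : ℂ))
        * star (U : Matrix n n ℂ) := by
  refine ⟨hA.isHermitian.eigenvectorUnitary, hA.isHermitian.eigenvalues, hA.eigenvalues_nonneg,
    fun t => ?_⟩
  rw [mpow, hA.isHermitian.cfc_eq]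
  rfl

lemma mpow_zero {n : Type*} [Fintype n] [DecidableEq n] {A : Matrix n n ℂ}
    (hA : A.IsHermitian) : mpow A 0 = 1 := by
  have := hA.isSelfAdjoint
  simp only [mpow, rpow_zero]
  exact cfc_const_one ℝ A

lemma mpow_one {n : Type*} [Fintype n] [DecidableEq n] {A : Matrix n n ℂ}
    (hA : A.IsHermitian) : mpow A 1 = A := by
  have := hA.isSelfAdjoint
  simp only [mpow, rpow_one]
  exact cfc_id' ℝ A

/-- Simultaneous diagonalization of all the maps `X ↦ A ^ s * X * B ^ t`. -/
lemma exists_schur_multiplier {n : Type*} [Fintype n] [DecidableEq n] {A B : Matrix n n ℂ}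
    (X : Matrix n n ℂ) (hA : A.PosSemidef) (hB : B.PosSemidef) :
    ∃ (a b : n → ℝ) (w : n → n → ℝ) (Φ : (n → n → ℝ) →ₗ[ℝ] Matrix n n ℂ),
      (∀ i, 0 ≤ a i) ∧ (∀ i, 0 ≤ b i) ∧ (∀ i j, 0 ≤ w i j) ∧
      (∀ c, hsNorm (Φ c) ^ 2 = ∑ i, ∑ j, c i j ^ 2 * w i j) ∧
      ∀ s t, mpow A s * X * mpow B t = Φ (fun i j => a i ^ s * b j ^ t) := by
  obtain ⟨U, a, ha, hU⟩ := exists_mpow_eq_conj hA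
  obtain ⟨V, b, hb, hV⟩ := exists_mpow_eq_conj hB
  obtain ⟨Y, hY⟩ : ∃ Y, Y = star (U : Matrix n n ℂ) * X * (V : Matrix n n ℂ) := ⟨_, rfl⟩
  let Φ : (n → n → ℝ) →ₗ[ℝ] Matrix n n ℂ :=
    { toFun := fun c => (U : Matrix n n ℂ) * Matrix.of (fun i j => (c i j : ℂ) * Y i j)
        * star (V : Matrix n n ℂ)
      map_add' := fun c d => by
        rw [← add_mul, ← mul_add]
        congr 2
        ext i j
        simp [add_mul]
      map_smul' := fun r c => by
        rw [RingHom.id_apply, ← smul_mul_assoc, ← mul_smul_comm]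
        congr 2
        ext i j
        simp [mul_assoc] }
  have hΦ (c : n → n → ℝ) : Φ c = (U : Matrix n n ℂ)
      * Matrix.of (fun i j => (c i j : ℂ) * Y i j) * star (V : Matrix n n ℂ) := rfl
  refine ⟨a, b, fun i j => ‖Y i j‖ ^ 2, Φ, ha, hb, fun _ _ => by positivity, fun c => ?_,
    fun s t => ?_⟩
  · rw [hΦ, sq_hsNorm_unitary_conj, sq_hsNorm]
    simp [mul_pow]
  · have hD : Matrix.of (fun i j => ((a i ^ s * b j ^ t : ℝ) : ℂ) * Y i j)
        = Matrix.diagonal (fun i => ((a i ^ s : ℝ) : ℂ)) * Y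
          * Matrix.diagonal (fun i => ((b i ^ t : ℝ) : ℂ)) := by
      ext i j
      simp only [Matrix.mul_diagonal, Matrix.diagonal_mul, Matrix.of_apply, Complex.ofReal_mul]
      ring
    rw [hΦ, hD, hU, hV, hY]
    simp only [mul_assoc]

theorem stmt17 {n : Type*} [Fintype n] [DecidableEq n]
    (A B X : Matrix n n ℂ) (hA : A.PosSemidef) (hB : B.PosSemidef)
    (ν : ℝ) (h0 : 0 ≤ ν) (h1 : ν ≤ 1) (N : ℕ) (hN : 2 ≤ N) :
    hsNorm (mpow A ν * X * mpow B (1 - ν))^2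
      + (sj 1 ν)^2 * hsNorm (A * X - X * B)^2
      + ∑ j ∈ Finset.Icc 2 N, sj j ν *
          hsNorm (mpow A ((kj j ν : ℝ)/2^(j-1)) * X * mpow B (1 - (kj j ν : ℝ)/2^(j-1))
            - mpow A (((kj j ν : ℝ) + 1)/2^(j-1)) * X
                * mpow B (1 - ((kj j ν : ℝ) + 1)/2^(j-1)))^2
      ≤ hsNorm (ν • (A * X) + (1 - ν) • (X * B))^2 := by
  obtain ⟨a, b, w, Φ, ha, hb, hw, hnorm, hΦ⟩ := exists_schur_multiplier X hA hB
  let G (y : ℝ) : n → n → ℝ := fun i j => wgm (a i) (b j) y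
  have hG (y : ℝ) : mpow A y * X * mpow B (1 - y) = Φ (G y) := hΦ y (1 - y)
  have hAX : A * X = Φ (G 1) := by
    rw [← hG, sub_self, mpow_one hA.isHermitian, mpow_zero hB.isHermitian, mul_one]
  have hXB : X * B = Φ (G 0) := by
    rw [← hG, sub_zero, mpow_one hB.isHermitian, mpow_zero hA.isHermitian, one_mul]
  simp only [hG, hAX, hXB, ← map_sub, ← map_smul, ← map_add, hnorm, Finset.mul_sum]
  rw [Finset.sum_comm (s := Finset.Icc 2 N), ← Finset.sum_add_distrib, ← Finset.sum_add_distrib]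
  refine Finset.sum_le_sum fun i _ => ?_
  rw [Finset.sum_comm (s := Finset.Icc 2 N), ← Finset.sum_add_distrib, ← Finset.sum_add_distrib]
  refine Finset.sum_le_sum fun j _ => ?_
  have h := mul_le_mul_of_nonneg_right
    (refined_young_sq (ha i) (hb j) h0 h1 N (by omega)) (hw i j)
  rw [add_mul, add_mul, Finset.sum_mul] at h
  simpa only [mul_assoc] using! h
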